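/- arXiv:2404.15179 — 2 statements merged into one kernel-verified Lean document; each statement's English description precedes it below -/
import Mathlib

section
/- Proposition 3 (even dimensions): Let d ≥ 2 be even. For all nonnegative reals a, b, c satisfying a² + b² + c² ≤ d − 1 and c² ≤ 1 + a² + b², there exists a d×d complex density matrix ρ with S_D(ρ) = a, S_X(ρ) = b and S_I(ρ) = c; i.e., these two inequalities completely characterize the attainable triples (S_D, S_X, S_I) in even dimension. -/
open Matrix
open scoped ComplexOrder

noncomputable section

/-- A density matrix: positive semidefinite with unit trace. -/
def IsDensityMatrix {d : ℕ} (ρ : Matrix (Fin d) (Fin d) ℂ) : Prop :=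
  ρ.PosSemidef ∧ ρ.trace = 1

/-- The diagonal part `D` of the decomposition `d·ρ = 𝟙 + D + X + I`. -/
def Dmat (d : ℕ) (ρ : Matrix (Fin d) (Fin d) ℂ) : Matrix (Fin d) (Fin d) ℂ :=
  Matrix.diagonal fun k => (d : ℂ) * ρ k k - 1

/-- The real off-diagonal part `X`: `X_kl = d·Re(ρ_kl)` for `k ≠ l`, zero diagonal. -/
def Xmat (d : ℕ) (ρ : Matrix (Fin d) (Fin d) ℂ) : Matrix (Fin d) (Fin d) ℂ :=
  Matrix.of fun k l => if k = l then 0 else (((d : ℝ) * (ρ k l).re : ℝ) : ℂ)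

/-- The imaginary off-diagonal part `I`: `I_kl = i·d·Im(ρ_kl)` for `k ≠ l`, zero diagonal. -/
def Imat (d : ℕ) (ρ : Matrix (Fin d) (Fin d) ℂ) : Matrix (Fin d) (Fin d) ℂ :=
  Matrix.of fun k l => if k = l then 0 else Complex.I * (((d : ℝ) * (ρ k l).im : ℝ) : ℂ)

/-- `S_D = √(Tr(D²)/d)`. -/
def SD (d : ℕ) (ρ : Matrix (Fin d) (Fin d) ℂ) : ℝ :=
  Real.sqrt ((Dmat d ρ * Dmat d ρ).trace.re / d)

/-- `S_X = √(Tr(X²)/d)`. -/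
def SX (d : ℕ) (ρ : Matrix (Fin d) (Fin d) ℂ) : ℝ :=
  Real.sqrt ((Xmat d ρ * Xmat d ρ).trace.re / d)

/-- `S_I = √(Tr(I²)/d)`. -/
def SI (d : ℕ) (ρ : Matrix (Fin d) (Fin d) ℂ) : ℝ :=
  Real.sqrt ((Imat d ρ * Imat d ρ).trace.re / d)

/-- The spreads of a density matrix in terms of sums over all its entries. -/
lemma spreads_eq_of_sums {d : ℕ} (hd : 0 < d) {ρ : Matrix (Fin d) (Fin d) ℂ}
    (hρ : ρ.IsHermitian) (htr : ρ.trace = 1) {a b c : ℝ}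
    (ha : 0 ≤ a) (hb : 0 ≤ b) (hc : 0 ≤ c)
    (hdiag : (d : ℝ) * ∑ k, (ρ k k).re ^ 2 = 1 + a ^ 2)
    (hre : (d : ℝ) * ∑ k, ∑ l, (ρ k l).re ^ 2 = 1 + a ^ 2 + b ^ 2)
    (him : (d : ℝ) * ∑ k, ∑ l, (ρ k l).im ^ 2 = c ^ 2) :
    SD d ρ = a ∧ SX d ρ = b ∧ SI d ρ = c := by
  have hd' : (0 : ℝ) < d := by exact_mod_cast hd
  have hsymm (k l : Fin d) : (ρ l k).re = (ρ k l).re ∧ (ρ l k).im = -(ρ k l).im := by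
    rw [← hρ.apply l k]; simp
  have hdim (k : Fin d) : (ρ k k).im = 0 := by
    have := (hsymm k k).2
    linarith
  have htr' : ∑ k, (ρ k k).re = 1 := by
    have := congrArg Complex.re htr
    simpa [Matrix.trace] using this
  have hD : (Dmat d ρ * Dmat d ρ).trace.re = d * a ^ 2 := by
    have h1 : (Dmat d ρ * Dmat d ρ).trace.re = ∑ k, ((d : ℝ) * (ρ k k).re - 1) ^ 2 := by
      simp [Dmat, Matrix.trace, hdim]
      exact Finset.sum_congr rfl fun k _ => by ring
    have h2 : ∑ k, ((d : ℝ) * (ρ k k).re - 1) ^ 2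
        = d * (d * ∑ k, (ρ k k).re ^ 2) - 2 * d * ∑ k, (ρ k k).re + d := by
      simp only [sub_sq, mul_pow, Finset.sum_add_distrib, Finset.sum_sub_distrib, Finset.mul_sum]
      simp
      congr 1
      · exact Finset.sum_congr rfl fun k _ => by ring
      · exact Finset.sum_congr rfl fun k _ => by ring
    rw [h1, h2, hdiag, htr']; ring
  have hX : (Xmat d ρ * Xmat d ρ).trace.re = d * b ^ 2 := by
    have h1 : (Xmat d ρ * Xmat d ρ).trace.re
        = ∑ k, ∑ l, (d ^ 2 * (ρ k l).re ^ 2 - if k = l then d ^ 2 * (ρ k l).re ^ 2 else 0) := by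
      simp only [Matrix.trace, Matrix.diag_apply, Matrix.mul_apply, Complex.re_sum]
      refine Finset.sum_congr rfl fun k _ => Finset.sum_congr rfl fun l _ => ?_
      by_cases h : k = l
      · simp [Xmat, h]
      · simp [Xmat, h, Ne.symm h, (hsymm k l).1]; ring
    rw [h1]
    simp only [Finset.sum_sub_distrib, Finset.sum_ite_eq, Finset.mem_univ, if_true,
      ← Finset.mul_sum]
    linear_combination (d : ℝ) * hre - d * hdiag
  have hI : (Imat d ρ * Imat d ρ).trace.re = d * c ^ 2 := by
    have h1 : (Imat d ρ * Imat d ρ).trace.re = ∑ k, ∑ l, d ^ 2 * (ρ k l).im ^ 2 := by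
      simp only [Matrix.trace, Matrix.diag_apply, Matrix.mul_apply, Complex.re_sum]
      refine Finset.sum_congr rfl fun k _ => Finset.sum_congr rfl fun l _ => ?_
      by_cases h : k = l
      · subst h; simp [Imat, hdim]
      · simp [Imat, h, Ne.symm h, (hsymm k l).2]; ring
    rw [h1]
    simp only [← Finset.mul_sum]
    linear_combination (d : ℝ) * him
  refine ⟨?_, ?_, ?_⟩
  · rw [SD, hD, mul_div_cancel_left₀ _ hd'.ne', Real.sqrt_sq ha]
  · rw [SX, hX, mul_div_cancel_left₀ _ hd'.ne', Real.sqrt_sq hb]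
  · rw [SI, hI, mul_div_cancel_left₀ _ hd'.ne', Real.sqrt_sq hc]

/-- A probability vector on `m` points can have any collision probability in `[1/m, 1]`. -/
lemma exists_probability_sum_sq {m : ℕ} (hm : 0 < m) {P : ℝ} (hP : 1 ≤ m * P) (hP1 : P ≤ 1) :
    ∃ p : Fin m → ℝ, (∀ i, 0 ≤ p i) ∧ ∑ i, p i = 1 ∧ ∑ i, p i ^ 2 = P := by
  have hm' : (1 : ℝ) ≤ m := by exact_mod_cast hm
  have hm0 : (m : ℝ) ≠ 0 := by positivity
  obtain ⟨s, hs0, hs1, hs⟩ : ∃ s : ℝ, 0 ≤ s ∧ s ≤ 1 ∧ s ^ 2 * (m - 1) = m * P - 1 := by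
    rcases hm'.eq_or_lt with h | h
    · exact ⟨0, le_rfl, zero_le_one, by rw [← h] at hP ⊢; linarith⟩
    · have h' : (0 : ℝ) < m - 1 := by linarith
      refine ⟨√((m * P - 1) / (m - 1)), Real.sqrt_nonneg _, ?_, ?_⟩
      · rw [Real.sqrt_le_one, div_le_one h']
        nlinarith
      · rw [Real.sq_sqrt (div_nonneg (by linarith) h'.le), div_mul_cancel₀ _ h'.ne']
  let i₀ : Fin m := ⟨0, hm⟩
  refine ⟨fun i => (1 - s) / m + if i = i₀ then s else 0, fun i => ?_, ?_, ?_⟩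
  · have : 0 ≤ (1 - s) / m := div_nonneg (by linarith) (by linarith)
    dsimp only
    split_ifs <;> linarith
  · simp [Finset.sum_add_distrib]
    field_simp
    ring
  · have h (i : Fin m) : ((1 - s) / m + if i = i₀ then s else 0) ^ 2
        = ((1 - s) / m) ^ 2 + if i = i₀ then 2 * ((1 - s) / m) * s + s ^ 2 else 0 := by
      split_ifs <;> ring
    simp only [h, Finset.sum_add_distrib]
    simp
    field_simp
    linear_combination hs

/-- Real density matrices with prescribed sum of squares on the diagonal and in total. -/
lemma exists_real_density {m : ℕ} (hm : 0 < m) {P Q : ℝ} (hP : 1 ≤ m * P) (hPQ : P ≤ Q)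
    (hQ : Q ≤ 1) :
    ∃ σ : Matrix (Fin m) (Fin m) ℝ, (σ.map ((↑) : ℝ → ℂ)).PosSemidef ∧ ∑ i, σ i i = 1 ∧
      ∑ i, σ i i ^ 2 = P ∧ ∑ i, ∑ j, σ i j ^ 2 = Q := by
  obtain ⟨p, hp0, hp1, hp2⟩ := exists_probability_sum_sq hm hP (hPQ.trans hQ)
  obtain ⟨κ, hκ0, hκ1, hκ⟩ : ∃ κ : ℝ, 0 ≤ κ ∧ κ ≤ 1 ∧ κ ^ 2 * (1 - P) = Q - P := by
    rcases (hPQ.trans hQ).eq_or_lt with h | h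
    · exact ⟨0, le_rfl, zero_le_one, by linarith⟩
    · have h' : 0 < 1 - P := by linarith
      refine ⟨√((Q - P) / (1 - P)), Real.sqrt_nonneg _, ?_, ?_⟩
      · rw [Real.sqrt_le_one, div_le_one h']
        linarith
      · rw [Real.sq_sqrt (div_nonneg (by linarith) h'.le), div_mul_cancel₀ _ h'.ne']
  have hdiag (i : Fin m) : κ * (√(p i) * √(p i)) + (1 - κ) * p i = p i := by
    rw [Real.mul_self_sqrt (hp0 i)]; ring
  refine ⟨.of fun i j => κ * (√(p i) * √(p j)) + if i = j then (1 - κ) * p i else 0,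
    ?_, ?_, ?_, ?_⟩
  · have h1 := (posSemidef_vecMulVec_self_star fun i : Fin m => ((√(p i) : ℝ) : ℂ)).smul
      (show (0 : ℂ) ≤ (κ : ℂ) by exact_mod_cast hκ0)
    have h2 : (Matrix.diagonal fun i : Fin m => (((1 - κ) * p i : ℝ) : ℂ)).PosSemidef :=
      Matrix.PosSemidef.diagonal fun i => by
        exact Complex.zero_le_real.2 (mul_nonneg (sub_nonneg.2 hκ1) (hp0 i))
    convert h1.add h2 using 1
    ext i j
    by_cases h : i = j <;> simp [h, Matrix.vecMulVec_apply]
  · simp [hdiag, hp1]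
  · simp [hdiag, hp2]
  · have h (i j : Fin m) : (κ * (√(p i) * √(p j)) + if i = j then (1 - κ) * p i else 0) ^ 2
        = κ ^ 2 * (p i * p j) + if i = j then (1 - κ ^ 2) * p i ^ 2 else 0 := by
      by_cases h : i = j
      · subst h
        simp only [if_true, hdiag]
        ring
      · simp [h, mul_pow, Real.sq_sqrt, hp0]
    simp only [Matrix.of_apply, h, Finset.sum_add_distrib, Finset.sum_ite_eq, Finset.mem_univ,
      if_true, ← Finset.mul_sum, hp1, hp2, mul_one]
    linear_combination hκ

/-- Qubit states with prescribed diagonal sum of squares and off-diagonal entry. -/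
lemma exists_qubit_density {t : ℝ} {z : ℂ} (ht : 1 / 2 ≤ t)
    (hz : z.re ^ 2 + z.im ^ 2 ≤ (1 - t) / 2) :
    ∃ τ : Matrix (Fin 2) (Fin 2) ℂ, τ.PosSemidef ∧ τ.trace = 1 ∧
      ∑ s, (τ s s).re ^ 2 = t ∧ (∀ s, (τ s s).im = 0) ∧
      ∑ r, ∑ s, (τ r s).re ^ 2 = t + 2 * z.re ^ 2 ∧
      ∑ r, ∑ s, (τ r s).im ^ 2 = 2 * z.im ^ 2 := by
  obtain ⟨w, hw0, hw⟩ : ∃ w : ℝ, 0 ≤ w ∧ w ^ 2 = 2 * t - 1 :=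
    ⟨√(2 * t - 1), Real.sqrt_nonneg _, Real.sq_sqrt (by linarith)⟩
  obtain ⟨p, hp⟩ : ∃ p : ℝ, p = (1 + w) / 2 := ⟨_, rfl⟩
  have hp0 : 0 < p := by linarith
  have hpt : p ^ 2 + (1 - p) ^ 2 = t := by rw [hp]; linear_combination hw / 2
  have hq : 0 ≤ 1 - p - (z.re ^ 2 + z.im ^ 2) / p := by
    rw [sub_nonneg, div_le_iff₀ hp0]
    nlinarith
  refine ⟨!![(p : ℂ), z; star z, ((1 - p : ℝ) : ℂ)], ?_, ?_, ?_, ?_, ?_, ?_⟩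
  · have h1 := posSemidef_vecMulVec_self_star ![((√p : ℝ) : ℂ), star z / ((√p : ℝ) : ℂ)]
    have h2 : (Matrix.diagonal
        ![0, ((1 - p - (z.re ^ 2 + z.im ^ 2) / p : ℝ) : ℂ)]).PosSemidef :=
      Matrix.PosSemidef.diagonal fun i => by
        fin_cases i
        · simp
        · exact Complex.zero_le_real.2 hq
    have hs0 : ((√p : ℝ) : ℂ) ≠ 0 := by exact_mod_cast (Real.sqrt_pos.2 hp0).ne'
    have hss : ((√p : ℝ) : ℂ) * ((√p : ℝ) : ℂ) = p := by
      exact_mod_cast Real.mul_self_sqrt hp0.le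
    have hzz : star z * z = ((z.re ^ 2 + z.im ^ 2 : ℝ) : ℂ) := by
      apply Complex.ext <;> simp [-Complex.ofReal_add, -Complex.ofReal_pow] <;> ring
    convert h1.add h2 using 1
    have hzz' : star z / ((√p : ℝ) : ℂ) * (z / ((√p : ℝ) : ℂ))
        = ((z.re ^ 2 + z.im ^ 2 : ℝ) : ℂ) / p := by
      rw [div_mul_div_comm, hss, hzz]
    ext i j
    rw [Matrix.add_apply, Matrix.vecMulVec_apply, Pi.star_apply]
    fin_cases i <;> fin_cases j
    · simp [hss]
    · simp
      field_simp
    · simp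
      field_simp
    · simp at hzz' ⊢
      rw [hzz']
      ring
  · simp [Matrix.trace]
  · simp [hpt]
  · intro s
    fin_cases s <;> simp
  · simp [Fin.sum_univ_two]
    linear_combination hpt
  · simp [Fin.sum_univ_two]
    ring

/-- Spreads of a product of a real `m × m` state and a qubit state. -/
lemma exists_density_of_product_parameters {m : ℕ} (hm : 0 < m) {a b c P Q t : ℝ} {z : ℂ}
    (ha : 0 ≤ a) (hb : 0 ≤ b) (hc : 0 ≤ c)
    (hP : 1 ≤ m * P) (hPQ : P ≤ Q) (hQ : Q ≤ 1)
    (ht : 1 / 2 ≤ t) (hz : z.re ^ 2 + z.im ^ 2 ≤ (1 - t) / 2)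
    (hdiag : 2 * m * P * t = 1 + a ^ 2)
    (hre : 2 * m * Q * (t + 2 * z.re ^ 2) = 1 + a ^ 2 + b ^ 2)
    (him : 2 * m * Q * (2 * z.im ^ 2) = c ^ 2) :
    ∃ ρ : Matrix (Fin (m * 2)) (Fin (m * 2)) ℂ, IsDensityMatrix ρ ∧
      SD (m * 2) ρ = a ∧ SX (m * 2) ρ = b ∧ SI (m * 2) ρ = c := by
  obtain ⟨σ, hσ, hσtr, hσP, hσQ⟩ := exists_real_density hm hP hPQ hQ
  obtain ⟨τ, hτ, hτtr, hτd, hτi, hτre, hτim⟩ := exists_qubit_density ht hz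
  let e : Fin m × Fin 2 ≃ Fin (m * 2) := finProdFinEquiv
  let ρ : Matrix (Fin (m * 2)) (Fin (m * 2)) ℂ :=
    (Matrix.kronecker (σ.map ((↑) : ℝ → ℂ)) τ).submatrix e.symm e.symm
  have hρe (x y : Fin m × Fin 2) : ρ (e x) (e y) = (σ x.1 y.1 : ℂ) * τ x.2 y.2 := by
    simp [ρ, Matrix.kronecker, Matrix.kroneckerMap_apply]
  have hρ : ρ.PosSemidef := (hσ.kronecker hτ).submatrix _
  have htr : ρ.trace = 1 := by
    rw [Matrix.trace, ← e.sum_comp]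
    simp only [Matrix.diag_apply, hρe, Fintype.sum_prod_type, ← Finset.mul_sum]
    have h : ∑ i, τ i i = 1 := hτtr
    rw [h]
    simp only [mul_one]
    exact_mod_cast hσtr
  have hsum (f : ℂ → ℝ) (g : ℝ → ℝ) (h : ∀ (x : ℝ) (w : ℂ), f (x * w) = g x * f w) :
      ∑ k, ∑ l, f (ρ k l) = (∑ i, ∑ j, g (σ i j)) * ∑ r, ∑ s, f (τ r s) := by
    rw [← e.sum_comp]
    simp only [← e.sum_comp (fun l => f (ρ _ l)), hρe, h, Fintype.sum_prod_type]
    simp only [← Finset.sum_mul, ← Finset.mul_sum]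
  refine ⟨ρ, ⟨hρ, htr⟩, spreads_eq_of_sums (by omega) hρ.1 htr ha hb hc ?_ ?_ ?_⟩
  · rw [← e.sum_comp]
    simp only [hρe, Fintype.sum_prod_type, Complex.re_ofReal_mul, mul_pow, ← Finset.mul_sum, hτd,
      ← Finset.sum_mul, hσP]
    push_cast
    linear_combination hdiag
  · rw [hsum (fun w => w.re ^ 2) (fun x => x ^ 2) fun x w => by simp [mul_pow], hσQ, hτre]
    push_cast
    linear_combination hre
  · rw [hsum (fun w => w.im ^ 2) (fun x => x ^ 2) fun x w => by simp [mul_pow], hσQ, hτim]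
    push_cast
    linear_combination him

/-- **Proposition 3, even dimensions.** Let `d ≥ 2` be even. For all
nonnegative reals `a, b, c` with `a² + b² + c² ≤ d − 1` and `c² ≤ 1 + a² + b²`,
there is a `d×d` density matrix with `S_D = a`, `S_X = b`, `S_I = c`. -/
theorem attainable_triples_even (d : ℕ) (hd : 2 ≤ d) (hdeven : Even d)
    (a b c : ℝ) (ha : 0 ≤ a) (hb : 0 ≤ b) (hc : 0 ≤ c)
    (hpurity : a ^ 2 + b ^ 2 + c ^ 2 ≤ (d : ℝ) - 1)
    (hquad : c ^ 2 ≤ 1 + a ^ 2 + b ^ 2) :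
    ∃ ρ : Matrix (Fin d) (Fin d) ℂ, IsDensityMatrix ρ ∧
      SD d ρ = a ∧ SX d ρ = b ∧ SI d ρ = c := by
  obtain ⟨m, rfl⟩ : ∃ m, d = m * 2 := by
    obtain ⟨m, rfl⟩ := hdeven
    exact ⟨m, by ring⟩
  have hm : 0 < m := by omega
  have hm1 : (1 : ℝ) ≤ m := by exact_mod_cast hm
  have hm0 : (0 : ℝ) < m := by linarith
  push_cast at hpurity
  rcases le_or_gt (1 + a ^ 2) (m : ℝ) with h | h
  · obtain ⟨R, hR⟩ : ∃ R : ℝ, R = min (m : ℝ) (1 + a ^ 2 + b ^ 2) := ⟨_, rfl⟩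
    have hRm : R ≤ m := hR ▸ min_le_left _ _
    have hRab : R ≤ 1 + a ^ 2 + b ^ 2 := hR ▸ min_le_right _ _
    have hRa : 1 + a ^ 2 ≤ R := hR ▸ le_min h (by nlinarith)
    have hRq : 1 + a ^ 2 + b ^ 2 + c ^ 2 ≤ 2 * R := by
      rcases min_choice (m : ℝ) (1 + a ^ 2 + b ^ 2) with h' | h' <;> rw [hR, h'] <;> linarith
    have hR0 : 0 < R := by nlinarith
    have hx := Real.sq_sqrt (show 0 ≤ ((1 + a ^ 2 + b ^ 2) / R - 1) / 4 from
      div_nonneg (sub_nonneg.2 ((one_le_div hR0).2 hRab)) (by norm_num))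
    have hy := Real.sq_sqrt (show 0 ≤ c ^ 2 / R / 4 by positivity)
    refine exists_density_of_product_parameters hm (P := (1 + a ^ 2) / m) (Q := R / m)
      (t := 1 / 2) (z := ⟨√(((1 + a ^ 2 + b ^ 2) / R - 1) / 4), √(c ^ 2 / R / 4)⟩)
      ha hb hc ?_ ?_ ?_ le_rfl ?_ ?_ ?_ ?_
    · rw [mul_div_cancel₀ _ hm0.ne']
      nlinarith
    · gcongr
    · rwa [div_le_one hm0]
    · dsimp only
      rw [hx, hy]
      have : (1 + a ^ 2 + b ^ 2) / R + c ^ 2 / R ≤ 2 := by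
        rw [← add_div, div_le_iff₀ hR0]
        exact hRq
      linarith
    · field_simp
    · dsimp only
      rw [hx]
      field_simp
      ring
    · dsimp only
      rw [hy]
      field_simp
      ring
  · have hx := Real.sq_sqrt (show 0 ≤ b ^ 2 / (4 * m) by positivity)
    have hy := Real.sq_sqrt (show 0 ≤ c ^ 2 / (4 * m) by positivity)
    refine exists_density_of_product_parameters hm (P := 1) (Q := 1)
      (t := (1 + a ^ 2) / (2 * m)) (z := ⟨√(b ^ 2 / (4 * m)), √(c ^ 2 / (4 * m))⟩)
      ha hb hc (by linarith) le_rfl le_rfl ?_ ?_ ?_ ?_ ?_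
    · rw [le_div_iff₀ (by positivity)]
      linarith
    · dsimp only
      rw [hx, hy]
      field_simp
      linarith
    · field_simp
    · dsimp only
      rw [hx]
      field_simp
      ring
    · dsimp only
      rw [hy]
      field_simp
      ring
end
end

section
/- Proposition 3 (odd dimensions): Let d ≥ 3 be odd. For all nonnegative reals a, b, c satisfying a² + b² + c² ≤ d − 1, c² ≤ 1 + a² + b², and the additional condition that √d·c ≤ √(d−1) + √(a² + b²) whenever a² + b² ≤ 1/(d−1), there exists a d×d complex density matrix ρ with S_D(ρ) = a, S_X(ρ) = b and S_I(ρ) = c; i.e., these inequalities completely characterize the attainable triples (S_D, S_X, S_I) in odd dimension. -/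
open Matrix
open scoped ComplexOrder

noncomputable section

section Invariants

variable {d : ℕ} {ρ : Matrix (Fin d) (Fin d) ℂ}

lemma re_apply_symm (h : ρ.IsHermitian) (k l : Fin d) : (ρ l k).re = (ρ k l).re := by
  rw [← h.apply k l]; simp

lemma im_apply_symm (h : ρ.IsHermitian) (k l : Fin d) : (ρ l k).im = -(ρ k l).im := by
  rw [← h.apply k l]; simp

lemma im_apply_self (h : ρ.IsHermitian) (k : Fin d) : (ρ k k).im = 0 := by
  have := im_apply_symm h k k
  linarith

lemma trace_Dmat_sq (h : ρ.IsHermitian) :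
    (Dmat d ρ * Dmat d ρ).trace.re = ∑ k, ((d : ℝ) * (ρ k k).re - 1) ^ 2 := by
  simp [Dmat, Matrix.diagonal_mul_diagonal, Matrix.trace_diagonal, Complex.re_sum,
    im_apply_self h, pow_two]

lemma trace_Xmat_sq (h : ρ.IsHermitian) :
    (Xmat d ρ * Xmat d ρ).trace.re =
      ∑ k, ∑ l, if k = l then 0 else (d : ℝ) ^ 2 * (ρ k l).re ^ 2 := by
  simp only [Xmat, Matrix.trace, Matrix.diag_apply, Matrix.mul_apply, Complex.re_sum,
    Matrix.of_apply]
  refine Finset.sum_congr rfl fun k _ => Finset.sum_congr rfl fun l _ => ?_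
  by_cases hkl : k = l
  · simp [hkl]
  · simp [hkl, Ne.symm hkl, re_apply_symm h k l]
    ring

lemma trace_Imat_sq (h : ρ.IsHermitian) :
    (Imat d ρ * Imat d ρ).trace.re = ∑ k, ∑ l, (d : ℝ) ^ 2 * (ρ k l).im ^ 2 := by
  simp only [Imat, Matrix.trace, Matrix.diag_apply, Matrix.mul_apply, Complex.re_sum,
    Matrix.of_apply]
  refine Finset.sum_congr rfl fun k _ => Finset.sum_congr rfl fun l _ => ?_
  by_cases hkl : k = l
  · subst hkl
    simp [im_apply_self h]
  · simp [hkl, Ne.symm hkl, im_apply_symm h k l]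
    ring

lemma trace_mul_self_re (h : ρ.IsHermitian) :
    (ρ * ρ).trace.re = ∑ k, ∑ l, (ρ k l).re ^ 2 + ∑ k, ∑ l, (ρ k l).im ^ 2 := by
  simp only [Matrix.trace, Matrix.diag_apply, Matrix.mul_apply, Complex.re_sum,
    ← Finset.sum_add_distrib]
  refine Finset.sum_congr rfl fun k _ => Finset.sum_congr rfl fun l _ => ?_
  rw [Complex.mul_re, re_apply_symm h k l, im_apply_symm h k l]
  ring

lemma trace_mul_transpose_re :
    (ρ * ρᵀ).trace.re = ∑ k, ∑ l, (ρ k l).re ^ 2 - ∑ k, ∑ l, (ρ k l).im ^ 2 := by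
  simp only [Matrix.trace, Matrix.diag_apply, Matrix.mul_apply, Complex.re_sum,
    ← Finset.sum_sub_distrib, Matrix.transpose_apply]
  refine Finset.sum_congr rfl fun k _ => Finset.sum_congr rfl fun l _ => ?_
  rw [Complex.mul_re]
  ring

lemma sum_re_diag (h : ρ.trace = 1) : ∑ k, (ρ k k).re = 1 := by
  have := congrArg Complex.re h
  simpa [Matrix.trace] using this

lemma trace_Dmat_sq_add_trace_Xmat_sq (h : ρ.IsHermitian) (ht : ρ.trace = 1) :
    (Dmat d ρ * Dmat d ρ).trace.re + (Xmat d ρ * Xmat d ρ).trace.re =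
      (d : ℝ) ^ 2 * ∑ k, ∑ l, (ρ k l).re ^ 2 - d := by
  have key : ∀ k, ((d : ℝ) * (ρ k k).re - 1) ^ 2 +
      ∑ l, (if k = l then 0 else (d : ℝ) ^ 2 * (ρ k l).re ^ 2) =
      (d : ℝ) ^ 2 * ∑ l, (ρ k l).re ^ 2 - 2 * d * (ρ k k).re + 1 := by
    intro k
    rw [Finset.mul_sum, ← Finset.add_sum_erase _ _ (Finset.mem_univ k),
      ← Finset.add_sum_erase _ (fun l => (d : ℝ) ^ 2 * (ρ k l).re ^ 2) (Finset.mem_univ k)]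
    have : ∑ l ∈ Finset.univ.erase k, (if k = l then 0 else (d : ℝ) ^ 2 * (ρ k l).re ^ 2) =
        ∑ l ∈ Finset.univ.erase k, (d : ℝ) ^ 2 * (ρ k l).re ^ 2 :=
      Finset.sum_congr rfl fun l hl => if_neg (Finset.ne_of_mem_erase hl).symm
    rw [this, if_pos rfl]
    ring
  rw [trace_Dmat_sq h, trace_Xmat_sq h, ← Finset.sum_add_distrib,
    Finset.sum_congr rfl fun k _ => key k, Finset.sum_add_distrib, Finset.sum_sub_distrib,
    ← Finset.mul_sum, ← Finset.mul_sum, sum_re_diag ht]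
  simp
  ring

/-- Damping the imaginary part by a factor in `[0, 1]` preserves density matrices. -/
lemma exists_density_scale_im (h : IsDensityMatrix ρ) {t : ℝ} (ht₀ : 0 ≤ t) (ht₁ : t ≤ 1) :
    ∃ ρ' : Matrix (Fin d) (Fin d) ℂ, IsDensityMatrix ρ' ∧
      (∀ k l, (ρ' k l).re = (ρ k l).re) ∧ ∀ k l, (ρ' k l).im = t * (ρ k l).im := by
  have hH := h.1.isHermitian
  refine ⟨(((1 + t) / 2 : ℝ) : ℂ) • ρ + (((1 - t) / 2 : ℝ) : ℂ) • ρᵀ, ⟨?_, ?_⟩, ?_, ?_⟩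
  · refine (h.1.smul ?_).add (h.1.transpose.smul ?_)
    · exact Complex.zero_le_real.2 (by linarith)
    · exact Complex.zero_le_real.2 (by linarith)
  · rw [Matrix.trace_add, Matrix.trace_smul, Matrix.trace_smul, Matrix.trace_transpose, h.2]
    simp only [smul_eq_mul, mul_one]
    push_cast
    ring
  · intro k l
    simp only [Matrix.add_apply, Matrix.smul_apply, Matrix.transpose_apply, smul_eq_mul,
      Complex.add_re, Complex.re_ofReal_mul, re_apply_symm hH k l]
    ring
  · intro k l
    simp only [Matrix.add_apply, Matrix.smul_apply, Matrix.transpose_apply, smul_eq_mul,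
      Complex.add_im, Complex.im_ofReal_mul, im_apply_symm hH k l]
    ring

end Invariants

section Rotation

variable {d : ℕ}

/-- The rotation by the angle `θ` in the coordinate plane `(i, j)`. -/
def planeRotation (i j : Fin d) (θ : ℝ) : Matrix (Fin d) (Fin d) ℝ := fun k =>
  if k = i then Pi.single i (Real.cos θ) + Pi.single j (Real.sin θ)
  else if k = j then Pi.single i (-Real.sin θ) + Pi.single j (Real.cos θ)
  else Pi.single k 1

lemma planeRotation_mul_transpose {i j : Fin d} (hij : i ≠ j) (θ : ℝ) :
    planeRotation i j θ * (planeRotation i j θ)ᵀ = 1 := by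
  have hcs : Real.cos θ * Real.cos θ + Real.sin θ * Real.sin θ = 1 := by
    simpa [pow_two] using Real.cos_sq_add_sin_sq θ
  ext k l
  rw [Matrix.mul_apply_eq_vecMul, Matrix.one_apply]
  change planeRotation i j θ k ⬝ᵥ planeRotation i j θ l = _
  unfold planeRotation
  split_ifs <;> subst_vars <;> simp [dotProduct_add] <;> grind

/-- Conjugation by a real orthogonal matrix. -/
lemma density_conj {ρ : Matrix (Fin d) (Fin d) ℂ} (h : IsDensityMatrix ρ)
    {U : Matrix (Fin d) (Fin d) ℝ} (hU : U * Uᵀ = 1) :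
    let V := U.map Complex.ofReal
    IsDensityMatrix (V * ρ * Vᵀ) ∧
      ((V * ρ * Vᵀ) * (V * ρ * Vᵀ)).trace = (ρ * ρ).trace ∧
      ((V * ρ * Vᵀ) * (V * ρ * Vᵀ)ᵀ).trace = (ρ * ρᵀ).trace := by
  intro V
  have hVH : Vᴴ = Vᵀ := by
    ext k l
    simp [V]
  have hV : V * Vᵀ = 1 := by
    have := congrArg (fun M => M.map Complex.ofRealHom) hU
    simp only [Matrix.map_mul] at this
    rw [Matrix.transpose_map, Matrix.map_one _ (map_zero _) (map_one _)] at this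
    exact this
  have hV' : Vᵀ * V = 1 := mul_eq_one_comm.1 hV
  have conj_trace : ∀ M : Matrix (Fin d) (Fin d) ℂ, (V * M * Vᵀ).trace = M.trace := by
    intro M
    rw [Matrix.trace_mul_comm, ← Matrix.mul_assoc, hV', Matrix.one_mul]
  have conj_mul : ∀ M N : Matrix (Fin d) (Fin d) ℂ,
      (V * M * Vᵀ) * (V * N * Vᵀ) = V * (M * N) * Vᵀ := by
    intro M N
    calc (V * M * Vᵀ) * (V * N * Vᵀ) = V * M * (Vᵀ * V) * N * Vᵀ := by
          simp only [Matrix.mul_assoc]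
      _ = _ := by rw [hV']; simp only [Matrix.mul_assoc, Matrix.one_mul]
  refine ⟨⟨?_, ?_⟩, ?_, ?_⟩
  · rw [← hVH]
    exact h.1.mul_mul_conjTranspose_same V
  · rw [conj_trace, h.2]
  · rw [conj_mul, conj_trace]
  · have : (V * ρ * Vᵀ)ᵀ = V * ρᵀ * Vᵀ := by
      simp [Matrix.transpose_mul, Matrix.mul_assoc]
    rw [this, conj_mul, conj_trace]

lemma conj_apply_self (ρ : Matrix (Fin d) (Fin d) ℂ) (U : Matrix (Fin d) (Fin d) ℝ)
    (k : Fin d) :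
    ((U.map Complex.ofReal * ρ * (U.map Complex.ofReal)ᵀ) k k).re =
      U k ⬝ᵥ (ρ.map Complex.re) *ᵥ (U k) := by
  simp only [Matrix.mul_apply, Matrix.transpose_apply, Matrix.map_apply, dotProduct,
    Matrix.mulVec, Complex.re_sum, Complex.re_mul_ofReal, Complex.re_ofReal_mul,
    Finset.sum_mul, Finset.mul_sum]
  rw [Finset.sum_comm]
  refine Finset.sum_congr rfl fun a _ => Finset.sum_congr rfl fun b _ => ?_
  ring

/-- Rotating in a coordinate plane moves one diagonal entry to any value between two. -/
lemma exists_density_rotate {ρ : Matrix (Fin d) (Fin d) ℂ} (h : IsDensityMatrix ρ)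
    {i j : Fin d} (hij : i ≠ j) {y : ℝ} (hy₁ : (ρ j j).re ≤ y) (hy₂ : y ≤ (ρ i i).re) :
    ∃ ρ' : Matrix (Fin d) (Fin d) ℂ, IsDensityMatrix ρ' ∧
      (ρ' * ρ').trace = (ρ * ρ).trace ∧ (ρ' * ρ'ᵀ).trace = (ρ * ρᵀ).trace ∧
      (ρ' i i).re = y ∧ (ρ' j j).re = (ρ i i).re + (ρ j j).re - y ∧
      ∀ k, k ≠ i → k ≠ j → (ρ' k k).re = (ρ k k).re := by
  have hsym := re_apply_symm h.1.isHermitian i j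
  obtain ⟨θ, -, hθ⟩ : y ∈ (fun θ : ℝ => Real.cos θ ^ 2 * (ρ i i).re +
      Real.sin θ ^ 2 * (ρ j j).re + 2 * Real.cos θ * Real.sin θ * (ρ i j).re) ''
      Set.Icc 0 (Real.pi / 2) := by
    apply intermediate_value_Icc' (by positivity) (by fun_prop)
    simpa using ⟨hy₁, hy₂⟩
  obtain ⟨h₁, h₂, h₃⟩ := density_conj h (planeRotation_mul_transpose hij θ)
  have hcs := Real.cos_sq_add_sin_sq θ
  have hi : planeRotation i j θ i = Pi.single i (Real.cos θ) + Pi.single j (Real.sin θ) := by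
    simp [planeRotation]
  have hj : planeRotation i j θ j = Pi.single i (-Real.sin θ) + Pi.single j (Real.cos θ) := by
    simp [planeRotation, hij.symm]
  refine ⟨_, h₁, h₂, h₃, ?_, ?_, ?_⟩
  · rw [conj_apply_self, hi, ← hθ]
    simp [add_dotProduct, dotProduct_add, Matrix.mulVec_add, hsym]
    ring
  · rw [conj_apply_self, hj, ← hθ]
    simp [add_dotProduct, dotProduct_add, Matrix.mulVec_add, hsym]
    linear_combination ((ρ i i).re + (ρ j j).re) * hcs
  · intro k hki hkj
    have hk : planeRotation i j θ k = Pi.single k 1 := by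
      simp [planeRotation, hki, hkj]
    rw [conj_apply_self, hk]
    simp

/-- The spread of the diagonal can be lowered to any value by real orthogonal conjugation. -/
lemma exists_density_diag_spread (hd : 0 < d) {ρ : Matrix (Fin d) (Fin d) ℂ}
    (h : IsDensityMatrix ρ) {v : ℝ} (hv₀ : 0 ≤ v)
    (hv : v ≤ ∑ k, ((d : ℝ) * (ρ k k).re - 1) ^ 2) :
    ∃ ρ' : Matrix (Fin d) (Fin d) ℂ, IsDensityMatrix ρ' ∧
      (ρ' * ρ').trace = (ρ * ρ).trace ∧ (ρ' * ρ'ᵀ).trace = (ρ * ρᵀ).trace ∧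
      ∑ k, ((d : ℝ) * (ρ' k k).re - 1) ^ 2 = v := by
  have hd' : (0 : ℝ) < d := by exact_mod_cast hd
  induction hm : (Finset.univ.filter fun k => (d : ℝ) * (ρ k k).re - 1 ≠ 0).card
    using Nat.strong_induction_on generalizing ρ with
  | _ m ih =>
  by_cases hzero : ∀ k, (d : ℝ) * (ρ k k).re - 1 = 0
  · refine ⟨ρ, h, rfl, rfl, ?_⟩
    simp only [hzero] at hv ⊢
    simp at hv ⊢
    linarith
  push Not at hzero
  obtain ⟨k₀, hk₀⟩ := hzero
  have hsum : ∑ k, ((d : ℝ) * (ρ k k).re - 1) = 0 := by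
    rw [Finset.sum_sub_distrib, ← Finset.mul_sum, sum_re_diag h.2]
    simp
  obtain ⟨i, -, hi⟩ := Finset.exists_pos_of_sum_zero_of_exists_nonzero _ hsum
    ⟨k₀, Finset.mem_univ _, hk₀⟩
  obtain ⟨j, -, hj⟩ := Finset.exists_pos_of_sum_zero_of_exists_nonzero
    (fun k => -((d : ℝ) * (ρ k k).re - 1)) (by rw [Finset.sum_neg_distrib, hsum, neg_zero])
    ⟨k₀, Finset.mem_univ _, neg_ne_zero.2 hk₀⟩
  have hij : i ≠ j := by
    rintro rfl
    linarith
  set gi := (d : ℝ) * (ρ i i).re - 1 with hgi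
  set gj := (d : ℝ) * (ρ j j).re - 1 with hgj
  have step : ∀ y, 0 ≤ y → y ≤ gi → ∃ ρ' : Matrix (Fin d) (Fin d) ℂ, IsDensityMatrix ρ' ∧
      (ρ' * ρ').trace = (ρ * ρ).trace ∧ (ρ' * ρ'ᵀ).trace = (ρ * ρᵀ).trace ∧
      (d : ℝ) * (ρ' i i).re - 1 = y ∧
      (∀ k, k ≠ i → k ≠ j → (ρ' k k).re = (ρ k k).re) ∧
      ∑ k, ((d : ℝ) * (ρ' k k).re - 1) ^ 2 = ∑ k, ((d : ℝ) * (ρ k k).re - 1) ^ 2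
        - gi ^ 2 - gj ^ 2 + y ^ 2 + (gi + gj - y) ^ 2 := by
    intro y hy₀ hy
    obtain ⟨ρ', h₁, h₂, h₃, h₄, h₅, h₆⟩ := exists_density_rotate h hij (y := (y + 1) / d)
      (by rw [le_div_iff₀ hd']; linarith) (by rw [div_le_iff₀ hd']; linarith)
    have e₁ : (d : ℝ) * (ρ' i i).re - 1 = y := by
      rw [h₄]; field_simp; ring
    have e₂ : (d : ℝ) * (ρ' j j).re - 1 = gi + gj - y := by
      rw [h₅, hgi, hgj]; field_simp; ring
    refine ⟨ρ', h₁, h₂, h₃, e₁, h₆, ?_⟩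
    have hj_mem : j ∈ Finset.univ.erase i := Finset.mem_erase.2 ⟨hij.symm, Finset.mem_univ _⟩
    rw [← Finset.add_sum_erase _ _ (Finset.mem_univ i), ← Finset.add_sum_erase _ _ hj_mem,
      ← Finset.add_sum_erase _ (fun k => ((d : ℝ) * (ρ k k).re - 1) ^ 2) (Finset.mem_univ i),
      ← Finset.add_sum_erase _ (fun k => ((d : ℝ) * (ρ k k).re - 1) ^ 2) hj_mem, e₁, e₂,
      ← hgi, ← hgj]
    have : ∀ k ∈ (Finset.univ.erase i).erase j,
        ((d : ℝ) * (ρ' k k).re - 1) ^ 2 = ((d : ℝ) * (ρ k k).re - 1) ^ 2 := by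
      intro k hk
      rw [h₆ k (Finset.ne_of_mem_erase (Finset.mem_of_mem_erase hk)) (Finset.ne_of_mem_erase hk)]
    rw [Finset.sum_congr rfl this]
    ring
  rcases le_total (∑ k, ((d : ℝ) * (ρ k k).re - 1) ^ 2
      - gi ^ 2 - gj ^ 2 + 0 ^ 2 + (gi + gj - 0) ^ 2) v with hle | hle
  · obtain ⟨y, ⟨hy₀, hy₁⟩, hy⟩ : v ∈ (fun y : ℝ => ∑ k, ((d : ℝ) * (ρ k k).re - 1) ^ 2
        - gi ^ 2 - gj ^ 2 + y ^ 2 + (gi + gj - y) ^ 2) '' Set.Icc 0 gi := by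
      apply intermediate_value_Icc hi.le (by fun_prop)
      refine ⟨hle, hv.trans (le_of_eq ?_)⟩
      ring
    obtain ⟨ρ', h₁, h₂, h₃, -, -, h₄⟩ := step y hy₀ hy₁
    exact ⟨ρ', h₁, h₂, h₃, h₄.trans hy⟩
  · obtain ⟨ρ₁, h₁, h₂, h₃, h₄, h₅, h₆⟩ := step 0 le_rfl hi.le
    have hlt : (Finset.univ.filter fun k => (d : ℝ) * (ρ₁ k k).re - 1 ≠ 0).card < m := by
      rw [← hm]
      refine Finset.card_lt_card (Finset.ssubset_iff_of_subset ?_ |>.2 ⟨i, ?_, ?_⟩)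
      · intro k
        simp only [Finset.mem_filter, Finset.mem_univ, true_and]
        intro hk
        by_cases hki : k = i
        · subst hki
          exact hi.ne'
        by_cases hkj : k = j
        · subst hkj
          intro h0
          linarith
        · rwa [← h₅ k hki hkj]
      · simpa using hi.ne'
      · simpa using h₄
    obtain ⟨ρ', t₁, t₂, t₃, t₄⟩ := ih _ hlt h₁ (hle.trans_eq h₆.symm) rfl
    exact ⟨ρ', t₁, t₂.trans h₂, t₃.trans h₃, t₄⟩

end Rotation

section BlockState

/-- A factor of the block state: real and imaginary amplitudes in each pair of coordinates, and
an amplitude in the unpaired coordinate. -/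
def blockFactor {ι : Type*} [DecidableEq ι] (p q : ι → ℝ) (s : ℝ) :
    Matrix (Option ι) (Option (ι × Bool)) ℂ
  | some k, some (l, false) => if k = l then (p k : ℂ) else 0
  | some k, some (l, true) => if k = l then Complex.I * (q k : ℂ) else 0
  | some _, none => 0
  | none, some _ => 0
  | none, none => (s : ℂ)

/-- A state which is a direct sum of rank one blocks of size two and a block of size one. -/
lemma exists_density_blocks {d : ℕ} {ι : Type*} [Fintype ι] [DecidableEq ι]
    (e : Fin d ≃ Option (ι × Bool)) (p q : ι → ℝ) (s : ℝ)
    (hsum : ∑ k, (p k ^ 2 + q k ^ 2) + s ^ 2 = 1) :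
    ∃ ρ : Matrix (Fin d) (Fin d) ℂ, IsDensityMatrix ρ ∧
      ∑ k, (ρ k k).re ^ 2 = ∑ k, (p k ^ 4 + q k ^ 4) + s ^ 4 ∧
      (∑ k, ∑ l, (ρ k l).re ^ 2) = ∑ k, (p k ^ 4 + q k ^ 4) + s ^ 4 ∧
      (∑ k, ∑ l, (ρ k l).im ^ 2) = 2 * ∑ k, p k ^ 2 * q k ^ 2 := by
  set B := (blockFactor p q s)ᴴ * blockFactor p q s with hB
  have h1 : B none none = (s : ℂ) * s := by
    simp [hB, Matrix.mul_apply, blockFactor]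
  have h2 : ∀ k, B (some k) none = 0 := by
    rintro ⟨k, _ | _⟩ <;> simp [hB, Matrix.mul_apply, blockFactor]
  have h3 : ∀ k, B none (some k) = 0 := by
    rintro ⟨k, _ | _⟩ <;> simp [hB, Matrix.mul_apply, blockFactor]
  have h4 : ∀ k l, B (some (k, false)) (some (l, false)) =
      if k = l then ((p k ^ 2 : ℝ) : ℂ) else 0 := by
    intro k l
    simp [hB, Matrix.mul_apply, blockFactor, apply_ite, pow_two]
    grind
  have h5 : ∀ k l, B (some (k, true)) (some (l, true)) =
      if k = l then ((q k ^ 2 : ℝ) : ℂ) else 0 := by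
    intro k l
    have := Complex.I_sq
    simp [hB, Matrix.mul_apply, blockFactor, apply_ite, pow_two]
    grind
  have h6 : ∀ k l, B (some (k, false)) (some (l, true)) =
      if k = l then ((p k * q k : ℝ) : ℂ) * Complex.I else 0 := by
    intro k l
    simp [hB, Matrix.mul_apply, blockFactor, apply_ite]
    grind
  have h7 : ∀ k l, B (some (k, true)) (some (l, false)) =
      if k = l then -((p k * q k : ℝ) : ℂ) * Complex.I else 0 := by
    intro k l
    simp [hB, Matrix.mul_apply, blockFactor, apply_ite]
    grind
  refine ⟨B.submatrix e e, ⟨?_, ?_⟩, ?_, ?_, ?_⟩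
  · exact (Matrix.posSemidef_conjTranspose_mul_self _).submatrix e
  · have : (B.submatrix e e).trace = B.trace := Equiv.sum_comp e fun x => B x x
    rw [this]
    simp only [Matrix.trace, Matrix.diag_apply, Fintype.sum_option, Fintype.sum_prod_type,
      Fintype.sum_bool, h1, h4, h5, if_true]
    rw [← Complex.ofReal_one, ← hsum]
    push_cast
    rw [Finset.sum_congr rfl fun k _ => add_comm _ _]
    ring
  · refine (Equiv.sum_comp e fun x => (B x x).re ^ 2).trans ?_
    simp only [Fintype.sum_option, Fintype.sum_prod_type,
      Fintype.sum_bool, h1, h4, h5, if_true, Complex.ofReal_re, ← Complex.ofReal_mul, ← pow_mul]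
    rw [Finset.sum_congr rfl fun k _ => add_comm _ _]
    ring
  · refine (Equiv.sum_comp e fun x => ∑ l, (B x (e l)).re ^ 2).trans ?_
    simp only [fun x => Equiv.sum_comp e fun y => (B x y).re ^ 2]
    simp only [Fintype.sum_option, Fintype.sum_prod_type,
      Fintype.sum_bool, h1, h2, h3, h4, h5, h6, h7, apply_ite Complex.re, apply_ite (· ^ 2)]
    simp [← Complex.ofReal_mul]
    rw [Finset.sum_congr rfl fun k _ => add_comm _ _]
    simp [← pow_mul, ← Complex.ofReal_pow]
    ring
  · refine (Equiv.sum_comp e fun x => ∑ l, (B x (e l)).im ^ 2).trans ?_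
    simp only [fun x => Equiv.sum_comp e fun y => (B x y).im ^ 2]
    simp only [Fintype.sum_option, Fintype.sum_prod_type,
      Fintype.sum_bool, h1, h2, h3, h4, h5, h6, h7, apply_ite Complex.im, apply_ite (· ^ 2)]
    simp only [← Complex.ofReal_mul, ← Complex.ofReal_neg, Complex.im_ofReal_mul,
      Complex.ofReal_im, Complex.I_im, Complex.zero_im]
    simp [mul_pow, ← two_mul, Finset.mul_sum]

/-- Block states of odd dimension with one distinguished pair. -/
lemma exists_density_special_pair {d n : ℕ} (hd : d = 2 * (n + 1) + 1) {x y t z : ℝ}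
    (hx : 0 ≤ x) (hy : 0 ≤ y) (ht : 0 ≤ t) (hz : 0 ≤ z)
    (hsum : x + y + 2 * n * t + z = 1) :
    ∃ ρ : Matrix (Fin d) (Fin d) ℂ, IsDensityMatrix ρ ∧
      ∑ k, (ρ k k).re ^ 2 = x ^ 2 + y ^ 2 + 2 * n * t ^ 2 + z ^ 2 ∧
      (∑ k, ∑ l, (ρ k l).re ^ 2) = x ^ 2 + y ^ 2 + 2 * n * t ^ 2 + z ^ 2 ∧
      (∑ k, ∑ l, (ρ k l).im ^ 2) = 2 * (x * y + n * t ^ 2) := by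
  have hcard : Fintype.card (Fin d) =
      Fintype.card (Option (Option (Fin n) × Bool)) := by
    simp [hd]
    ring
  have pow4 : ∀ w : ℝ, √w ^ 4 = (√w ^ 2) ^ 2 := fun w => by ring
  obtain ⟨ρ, h₁, h₂, h₃, h₄⟩ := exists_density_blocks (Fintype.equivOfCardEq hcard)
    (fun k => k.elim √x fun _ => √t) (fun k => k.elim √y fun _ => √t) √z (by
      simp [Fintype.sum_option, Real.sq_sqrt, hx, hy, ht, hz]
      linarith)
  refine ⟨ρ, h₁, h₂.trans ?_, h₃.trans ?_, h₄.trans ?_⟩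
  · simp [Fintype.sum_option, pow4, Real.sq_sqrt, hx, hy, ht, hz]
    ring
  · simp [Fintype.sum_option, pow4, Real.sq_sqrt, hx, hy, ht, hz]
    ring
  · simp [Fintype.sum_option, Real.sq_sqrt, hx, hy, ht, ← pow_two]

end BlockState

section Attainable

/-- States with diagonal real part of prescribed spread `r` and maximal imaginary part. -/
lemma exists_density_large_im {d n : ℕ} (hdn : d = 2 * (n + 1) + 1) {r c : ℝ} (hr : 0 ≤ r)
    (hc : 0 ≤ c) (hpurity : r ^ 2 + c ^ 2 ≤ (d : ℝ) - 1) (hquad : c ^ 2 ≤ 1 + r ^ 2)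
    (hlin : r ^ 2 ≤ 1 / ((d : ℝ) - 1) → √(d : ℝ) * c ≤ √((d : ℝ) - 1) + r) :
    ∃ ρ : Matrix (Fin d) (Fin d) ℂ, IsDensityMatrix ρ ∧
      ∑ k, (ρ k k).re ^ 2 = (1 + r ^ 2) / d ∧
      (∑ k, ∑ l, (ρ k l).re ^ 2) = (1 + r ^ 2) / d ∧
      c ^ 2 / d ≤ ∑ k, ∑ l, (ρ k l).im ^ 2 := by
  have hn : (0 : ℝ) ≤ n := n.cast_nonneg
  have hd : (d : ℝ) = 2 * (n + 1) + 1 := by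
    rw [hdn]
    push_cast
    ring
  have hd₀ : (0 : ℝ) < d := by linarith
  suffices H : ∃ x y t z : ℝ, 0 ≤ x ∧ 0 ≤ y ∧ 0 ≤ t ∧ 0 ≤ z ∧ x + y + 2 * n * t + z = 1 ∧
      x ^ 2 + y ^ 2 + 2 * n * t ^ 2 + z ^ 2 = (1 + r ^ 2) / d ∧
      c ^ 2 / d ≤ 2 * (x * y + n * t ^ 2) by
    obtain ⟨x, y, t, z, hx, hy, ht, hz, hsum, hsq, him⟩ := H
    obtain ⟨ρ, h₁, h₂, h₃, h₄⟩ := exists_density_special_pair hdn hx hy ht hz hsum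
    exact ⟨ρ, h₁, h₂.trans hsq, h₃.trans hsq, him.trans_eq h₄.symm⟩
  rcases le_total (r ^ 2) (1 / ((d : ℝ) - 1)) with hsmall | hsmall
  · obtain ⟨w, hw, hw₀⟩ : ∃ w, w = √((d : ℝ) - 1) ∧ 0 < w :=
      ⟨_, rfl, Real.sqrt_pos.2 (by linarith)⟩
    have hw₂ : w ^ 2 = d - 1 := by
      rw [hw, Real.sq_sqrt (by linarith)]
    have hdw : (d : ℝ) = w ^ 2 + 1 := by linarith
    have hnw : 2 * (n : ℝ) = w ^ 2 - 2 := by linarith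
    have hrw : r * w ≤ 1 := by
      rw [← hw₂, le_div_iff₀ (by positivity)] at hsmall
      nlinarith [mul_nonneg hr hw₀.le]
    have hl := hlin hsmall
    rw [← hw] at hl
    have hl₂ : (d : ℝ) * c ^ 2 ≤ (w + r) ^ 2 := by
      have := pow_le_pow_left₀ (by positivity) hl 2
      rwa [mul_pow, Real.sq_sqrt hd₀.le] at this
    have hu : 0 ≤ (1 + r / w) / d := by positivity
    refine ⟨_, _, _, (1 - r * w) / d, hu, hu, hu, div_nonneg (by linarith) hd₀.le, ?_, ?_, ?_⟩
    · rw [hnw, hdw]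
      field_simp
      ring
    · rw [hnw, hdw]
      field_simp
      ring
    · have : 2 * ((1 + r / w) / d * ((1 + r / w) / d) + n * ((1 + r / w) / d) ^ 2) =
          (w + r) ^ 2 / d ^ 2 := by
        have : 2 * ((1 + r / w) / d * ((1 + r / w) / d) + n * ((1 + r / w) / d) ^ 2) =
          (2 + 2 * (n : ℝ)) * ((1 + r / w) / d) ^ 2 := by ring
        rw [this, hnw]
        field_simp
        ring
      rw [this, div_le_div_iff₀ hd₀ (by positivity)]
      nlinarith
  have hR : 1 ≤ r ^ 2 * ((d : ℝ) - 1) := by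
    rwa [div_le_iff₀ (by linarith)] at hsmall
  rcases le_total (1 + r ^ 2) ((d : ℝ) / 2) with hmid | hmid
  · obtain ⟨t, ⟨ht₀, ht₁⟩, ht⟩ : (1 + r ^ 2) / d ∈
        (fun t : ℝ => 2 * (1 / 2 - n * t) ^ 2 + 2 * n * t ^ 2) ''
        Set.Icc 0 (1 / (2 * ((n : ℝ) + 1))) := by
      apply intermediate_value_Icc' (by positivity) (by fun_prop)
      constructor
      · have : 2 * (1 / 2 - n * (1 / (2 * ((n : ℝ) + 1)))) ^ 2 +
            2 * n * (1 / (2 * ((n : ℝ) + 1))) ^ 2 = 1 / ((d : ℝ) - 1) := by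
          rw [hd]
          field_simp
          ring
        simp only [this]
        rw [div_le_div_iff₀ (by linarith) hd₀]
        linarith
      · rw [div_le_iff₀ hd₀]
        linarith
    dsimp only at ht
    have hs : 0 ≤ 1 / 2 - n * t := by
      rw [le_div_iff₀ (by positivity)] at ht₁
      nlinarith
    refine ⟨_, _, t, 0, hs, hs, ht₀, le_rfl, by ring, by rw [← ht]; ring, ?_⟩
    calc c ^ 2 / d ≤ (1 + r ^ 2) / d := by gcongr
      _ = _ := by rw [← ht]; ring
  · obtain ⟨x, ⟨hx₀, hx₁⟩, hx⟩ : (1 + r ^ 2) / d ∈ (fun x : ℝ => x ^ 2 + (1 - x) ^ 2) ''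
        Set.Icc (1 / 2) 1 := by
      apply intermediate_value_Icc (by norm_num) (by fun_prop)
      constructor
      · rw [le_div_iff₀ hd₀]
        linarith
      · rw [div_le_iff₀ hd₀]
        nlinarith
    dsimp only at hx
    refine ⟨x, 1 - x, 0, 0, by linarith, by linarith, le_rfl, le_rfl, by ring, by rw [← hx]; ring,
      ?_⟩
    calc c ^ 2 / d ≤ 1 - (1 + r ^ 2) / d := by
          rw [div_le_iff₀ hd₀, sub_mul, div_mul_cancel₀ _ hd₀.ne']
          linarith
      _ = _ := by rw [← hx]; ring

end Attainable

/-- **Proposition 3, odd dimensions.** Let `d ≥ 3` be odd. For all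
nonnegative reals `a, b, c` with `a² + b² + c² ≤ d − 1`, `c² ≤ 1 + a² + b²`, and
`√d·c ≤ √(d−1) + √(a² + b²)` whenever `a² + b² ≤ 1/(d−1)`, there is a `d×d`
density matrix with `S_D = a`, `S_X = b`, `S_I = c`. -/
theorem attainable_triples_odd (d : ℕ) (hd : 3 ≤ d) (hdodd : Odd d)
    (a b c : ℝ) (ha : 0 ≤ a) (hb : 0 ≤ b) (hc : 0 ≤ c)
    (hpurity : a ^ 2 + b ^ 2 + c ^ 2 ≤ (d : ℝ) - 1)
    (hquad : c ^ 2 ≤ 1 + a ^ 2 + b ^ 2)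
    (hlin : a ^ 2 + b ^ 2 ≤ 1 / ((d : ℝ) - 1) →
      Real.sqrt d * c ≤ Real.sqrt ((d : ℝ) - 1) + Real.sqrt (a ^ 2 + b ^ 2)) :
    ∃ ρ : Matrix (Fin d) (Fin d) ℂ, IsDensityMatrix ρ ∧
      SD d ρ = a ∧ SX d ρ = b ∧ SI d ρ = c := by
  obtain ⟨m, hm⟩ := hdodd
  obtain ⟨n, hdn⟩ : ∃ n, d = 2 * (n + 1) + 1 := ⟨m - 1, by omega⟩
  have hd₀ : (0 : ℝ) < d := by exact_mod_cast (by omega : 0 < d)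
  have hr₂ : √(a ^ 2 + b ^ 2) ^ 2 = a ^ 2 + b ^ 2 := Real.sq_sqrt (by positivity)
  obtain ⟨ρ₀, h₀, hdiag₀, hre₀, him₀⟩ := exists_density_large_im hdn
    (Real.sqrt_nonneg (a ^ 2 + b ^ 2)) hc (by rwa [hr₂]) (by rw [hr₂]; linarith)
    (by rwa [hr₂])
  rw [hr₂] at hdiag₀ hre₀
  set J := ∑ k, ∑ l, (ρ₀ k l).im ^ 2 with hJ
  have hJ₀ : 0 ≤ J := by positivity
  obtain ⟨t, ht₀, ht₁, ht⟩ : ∃ t : ℝ, 0 ≤ t ∧ t ≤ 1 ∧ t ^ 2 * J = c ^ 2 / d := by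
    have hcd : 0 ≤ c ^ 2 / d := by positivity
    refine ⟨√(c ^ 2 / d / J), Real.sqrt_nonneg _, ?_, ?_⟩
    · exact Real.sqrt_le_one.2 (div_le_one_of_le₀ him₀ hJ₀)
    · rw [Real.sq_sqrt (by positivity)]
      rcases hJ₀.eq_or_lt with hJ' | hJ'
      · rw [← hJ'] at him₀ ⊢
        linarith
      · exact div_mul_cancel₀ _ hJ'.ne'
  obtain ⟨ρ₁, h₁, hre₁, him₁⟩ := exists_density_scale_im h₀ ht₀ ht₁
  have hdev : ∑ k, ((d : ℝ) * (ρ₁ k k).re - 1) ^ 2 = d * (a ^ 2 + b ^ 2) := by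
    have : ∀ k, ((d : ℝ) * (ρ₁ k k).re - 1) ^ 2 =
        (d : ℝ) ^ 2 * (ρ₀ k k).re ^ 2 - 2 * d * (ρ₀ k k).re + 1 := by
      intro k
      rw [hre₁]
      ring
    simp only [this]
    rw [Finset.sum_add_distrib, Finset.sum_sub_distrib, ← Finset.mul_sum, ← Finset.mul_sum,
      sum_re_diag h₀.2, hdiag₀]
    simp only [Finset.sum_const, Finset.card_univ, Fintype.card_fin, nsmul_eq_mul]
    field_simp
    ring
  obtain ⟨ρ, h, htr, htrT, hspread⟩ := exists_density_diag_spread (by omega) h₁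
    (v := d * a ^ 2) (by positivity) (by rw [hdev]; nlinarith [mul_nonneg hd₀.le (sq_nonneg b)])
  have e₁ := congrArg Complex.re htr
  have e₂ := congrArg Complex.re htrT
  rw [trace_mul_self_re h.1.isHermitian, trace_mul_self_re h₁.1.isHermitian] at e₁
  rw [trace_mul_transpose_re, trace_mul_transpose_re] at e₂
  simp only [hre₁, him₁, mul_pow, ← Finset.mul_sum, hre₀, ← hJ, ht] at e₁ e₂
  have hre : ∑ k, ∑ l, (ρ k l).re ^ 2 = (1 + (a ^ 2 + b ^ 2)) / d := by linarith
  have him : ∑ k, ∑ l, (ρ k l).im ^ 2 = c ^ 2 / d := by linarith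
  have hD : (Dmat d ρ * Dmat d ρ).trace.re = d * a ^ 2 :=
    (trace_Dmat_sq h.1.isHermitian).trans hspread
  have hX : (Xmat d ρ * Xmat d ρ).trace.re = d * b ^ 2 := by
    have := trace_Dmat_sq_add_trace_Xmat_sq h.1.isHermitian h.2
    rw [hD, hre] at this
    field_simp at this
    linarith
  have hI : (Imat d ρ * Imat d ρ).trace.re = d * c ^ 2 := by
    rw [trace_Imat_sq h.1.isHermitian]
    simp only [← Finset.mul_sum, him]
    field_simp
  refine ⟨ρ, h, ?_, ?_, ?_⟩
  · rw [SD, hD, mul_div_cancel_left₀ _ hd₀.ne', Real.sqrt_sq ha]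
  · rw [SX, hX, mul_div_cancel_left₀ _ hd₀.ne', Real.sqrt_sq hb]
  · rw [SI, hI, mul_div_cancel_left₀ _ hd₀.ne', Real.sqrt_sq hc]
end
end
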